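/- Let n ≥ 2. Let A_{Bₙ} be the Artin group of type Bₙ, presented by generators s₁, …, sₙ with relations s₁s₂s₁s₂ = s₂s₁s₂s₁, sᵢs_{i+1}sᵢ = s_{i+1}sᵢs_{i+1} for 2 ≤ i ≤ n−1, and sᵢsⱼ = sⱼsᵢ for |i−j| ≥ 2; let W_{Bₙ} be the Coxeter group of type Bₙ (obtained by adding the relations sᵢ² = 1), and let π_S : A_{Bₙ} → W_{Bₙ} be the canonical surjection. Then there exist a group homomorphism f : A_{Bₙ} → B_{2n} with f(s₁) = σₙ and f(sᵢ) = σ_{n−i+1}σ_{n+i−1} for 2 ≤ i ≤ n, and an injective homomorphism e : W_{Bₙ} → S_{2n} with e(s₁) = (n, n+1) and e(sᵢ) = (n−i+1, n−i+2)(n+i−1, n+i) for 2 ≤ i ≤ n, such that π_{2n} ∘ f = e ∘ π_S. -/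

import Mathlib

/-!
Braid group infrastructure.

`BraidGroup m` is the Artin braid group on `m` strands, presented with generators
`σ 0, …, σ (m-2)` (here `σ i` denotes the usual generator `σ_{i+1}`) and the braid
relations `σ i * σ j = σ j * σ i` for `|i - j| ≥ 2` and
`σ i * σ j * σ i = σ j * σ i * σ j` for `j = i + 1`.
-/

/-- The braid relations on `m` strands (generators indexed by `Fin (m - 1)`). -/
def braidRels (m : ℕ) : Set (FreeGroup (Fin (m - 1))) :=
  { r | (∃ i j : Fin (m - 1), (i : ℕ) + 2 ≤ (j : ℕ) ∧
          r = FreeGroup.of i * FreeGroup.of j * (FreeGroup.of i)⁻¹ * (FreeGroup.of j)⁻¹) ∨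
        (∃ i j : Fin (m - 1), (j : ℕ) = (i : ℕ) + 1 ∧
          r = FreeGroup.of i * FreeGroup.of j * FreeGroup.of i *
              (FreeGroup.of j * FreeGroup.of i * FreeGroup.of j)⁻¹) }

/-- The braid group on `m` strands. -/
abbrev BraidGroup (m : ℕ) : Type := PresentedGroup (braidRels m)

/-- The braid generator `σ_{i+1}` of the braid group on `m` strands. -/
def σ {m : ℕ} (i : Fin (m - 1)) : BraidGroup m := PresentedGroup.of i

private lemma swap_commute {α : Type*} [DecidableEq α] {a b c d : α}
    (hac : a ≠ c) (had : a ≠ d) (hbc : b ≠ c) (hbd : b ≠ d) :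
    Equiv.swap a b * Equiv.swap c d = Equiv.swap c d * Equiv.swap a b := by
  have h := (Equiv.swap_apply_apply (Equiv.swap a b) c d).symm
  rw [Equiv.swap_apply_of_ne_of_ne hac.symm hbc.symm,
    Equiv.swap_apply_of_ne_of_ne had.symm hbd.symm] at h
  exact mul_inv_eq_iff_eq_mul.mp h

private lemma swap_braid {α : Type*} [DecidableEq α] {x y z : α}
    (hxy : x ≠ y) (hyz : y ≠ z) (hxz : x ≠ z) :
    Equiv.swap x y * Equiv.swap y z * Equiv.swap x y =
      Equiv.swap y z * Equiv.swap x y * Equiv.swap y z := by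
  have h1 := (Equiv.swap_apply_apply (Equiv.swap x y) y z).symm
  rw [Equiv.swap_apply_right, Equiv.swap_apply_of_ne_of_ne hxz.symm hyz.symm] at h1
  have h2 := (Equiv.swap_apply_apply (Equiv.swap y z) x y).symm
  rw [Equiv.swap_apply_of_ne_of_ne hxy hxz, Equiv.swap_apply_left] at h2
  rw [Equiv.swap_inv] at h1 h2
  calc Equiv.swap x y * Equiv.swap y z * Equiv.swap x y = Equiv.swap x z := h1
    _ = Equiv.swap y z * Equiv.swap x y * Equiv.swap y z := h2.symm

/-- The transposition `(i+1, i+2)`, as image of the braid generator `σ_{i+1}`. -/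
def braidGen (m : ℕ) (i : Fin (m - 1)) : Equiv.Perm (Fin m) :=
  Equiv.swap ⟨i.1, by have := i.isLt; omega⟩ ⟨i.1 + 1, by have := i.isLt; omega⟩

private lemma braid_rels_hold (m : ℕ) :
    ∀ r ∈ braidRels m, FreeGroup.lift (braidGen m) r = 1 := by
  rintro r (⟨i, j, hij, rfl⟩ | ⟨i, j, hij, rfl⟩) <;>
    simp only [map_mul, map_inv, FreeGroup.lift_apply_of]
  · rw [mul_inv_eq_one (a := _ * _ * _), mul_inv_eq_iff_eq_mul]
    unfold braidGen
    apply swap_commute <;> (simp only [ne_eq, Fin.mk.injEq]; omega)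
  · obtain ⟨jv, hjlt⟩ := j
    simp only [Fin.val_mk] at hij
    subst hij
    rw [mul_inv_eq_one (a := _ * _ * _)]
    unfold braidGen
    simp only [Fin.val_mk]
    apply swap_braid <;> (simp only [ne_eq, Fin.mk.injEq]; omega)

/-- The canonical surjection from the braid group on `m` strands to the symmetric
group on `m` letters, sending `σ_{i+1}` to the transposition `(i+1, i+2)`
(`0`-indexed: the swap of `i` and `i + 1` in `Fin m`). -/
def braidToPerm (m : ℕ) : BraidGroup m →* Equiv.Perm (Fin m) :=
  PresentedGroup.toGroup (braid_rels_hold m)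
/-- `altProd x y n` is the alternating product `x * y * x * y * ⋯` with `n` factors. -/
def altProd {G : Type*} [Monoid G] (x y : G) : ℕ → G
  | 0 => 1
  | n + 1 => x * altProd y x n

lemma altProd_add_two {G : Type*} [Monoid G] (x y : G) (n : ℕ) :
    altProd x y (n + 2) = x * y * altProd x y n := by
  simp [altProd, mul_assoc]

lemma altProd_two_mul {G : Type*} [Monoid G] (x y : G) (n : ℕ) :
    altProd x y (2 * n) = (x * y) ^ n := by
  induction n with
  | zero => simp [altProd]
  | succ m ih =>
    rw [show 2 * (m + 1) = 2 * m + 2 from by ring, altProd_add_two, ih, ← pow_succ']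

lemma altProd_two_mul_add_one {G : Type*} [Monoid G] (x y : G) (n : ℕ) :
    altProd x y (2 * n + 1) = (x * y) ^ n * x := by
  induction n with
  | zero => simp [altProd]
  | succ m ih =>
    rw [show 2 * (m + 1) + 1 = (2 * m + 1) + 2 from by ring, altProd_add_two, ih,
      ← mul_assoc, ← pow_succ']

/-- In a group, if `s` and `t` are involutions and `(s * t) ^ k = 1`, then the two
alternating products of `s` and `t` with `k` factors agree. -/
lemma altProd_swap_eq {G : Type*} [Group G] {s t : G} (hs : s * s = 1) (ht : t * t = 1)
    {k : ℕ} (h : (s * t) ^ k = 1) : altProd s t k = altProd t s k := by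
  have hs' : s⁻¹ = s := inv_eq_of_mul_eq_one_right hs
  have ht' : t⁻¹ = t := inv_eq_of_mul_eq_one_right ht
  have hts : t * s = (s * t)⁻¹ := by rw [mul_inv_rev, hs', ht']
  rcases Nat.even_or_odd k with ⟨m, hm⟩ | ⟨m, hm⟩
  · obtain rfl : k = 2 * m := by omega
    rw [altProd_two_mul, altProd_two_mul, hts, inv_pow]
    rw [show 2 * m = m + m from by ring, pow_add] at h
    exact (inv_eq_of_mul_eq_one_right h).symm
  · obtain rfl : k = 2 * m + 1 := by omega
    rw [altProd_two_mul_add_one, altProd_two_mul_add_one, hts, inv_pow]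
    rw [show 2 * m + 1 = m + (m + 1) from by ring, pow_add, pow_succ] at h
    rw [inv_eq_of_mul_eq_one_right h, mul_assoc, mul_assoc, ht, mul_one]

lemma map_altProd {G H : Type*} [Monoid G] [Monoid H] (φ : G →* H) (x y : G) (n : ℕ) :
    φ (altProd x y n) = altProd (φ x) (φ y) n := by
  induction n generalizing x y with
  | zero => simp [altProd]
  | succ m ih => simp [altProd, ih]
/-- The Coxeter matrix of type `Bₙ`, with `m s₁ s₂ = 4` (indices `0` and `1`),
`m sᵢ sᵢ₊₁ = 3` for `2 ≤ i` and `m sᵢ sⱼ = 2` for `|i - j| ≥ 2`. -/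
def BCoxMatrix (n : ℕ) : CoxeterMatrix (Fin n) where
  M := Matrix.of fun i j : Fin n ↦
    if i = j then 1
      else (if (i : ℕ) = 0 ∧ (j : ℕ) = 1 ∨ (j : ℕ) = 0 ∧ (i : ℕ) = 1 then 4
        else (if (j : ℕ) + 1 = i ∨ (i : ℕ) + 1 = j then 3 else 2))
  isSymm := by unfold Matrix.IsSymm; aesop
  diagonal := by simp
  off_diagonal := by aesop

/-- The Coxeter group of type `Bₙ`. -/
abbrev BCoxGroup (n : ℕ) : Type := (BCoxMatrix n).Group

/-- The defining relations of the Artin group of type `Bₙ`: for each pair of distinct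
generators, the two alternating products with `m i j` factors agree (`m i j` being the
entry of the type-`Bₙ` Coxeter matrix), i.e. `s₁s₂s₁s₂ = s₂s₁s₂s₁`,
`sᵢsᵢ₊₁sᵢ = sᵢ₊₁sᵢsᵢ₊₁` for `2 ≤ i`, and `sᵢsⱼ = sⱼsᵢ` for `|i - j| ≥ 2`. -/
def artinBRels (n : ℕ) : Set (FreeGroup (Fin n)) :=
  { r | ∃ i j : Fin n, i ≠ j ∧
      r = altProd (FreeGroup.of i) (FreeGroup.of j) (BCoxMatrix n i j) *
          (altProd (FreeGroup.of j) (FreeGroup.of i) (BCoxMatrix n i j))⁻¹ }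

/-- The Artin (generalized braid) group of type `Bₙ`. -/
abbrev ArtinB (n : ℕ) : Type := PresentedGroup (artinBRels n)

/-- The canonical surjection from the Artin group of type `Bₙ` onto the Coxeter group
of type `Bₙ` (adding the relations `sᵢ² = 1`). -/
def artinBToCox (n : ℕ) : ArtinB n →* BCoxGroup n :=
  PresentedGroup.toGroup (f := (BCoxMatrix n).simple)
    (by
      rintro r ⟨i, j, hij, rfl⟩
      rw [map_mul, map_inv, mul_inv_eq_one, map_altProd, map_altProd,
        FreeGroup.lift_apply_of, FreeGroup.lift_apply_of]
      exact altProd_swap_eq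
        ((BCoxMatrix n).toCoxeterSystem.simple_mul_simple_self i)
        ((BCoxMatrix n).toCoxeterSystem.simple_mul_simple_self j)
        ((BCoxMatrix n).toCoxeterSystem.simple_mul_simple_pow i j))

section BraidSequence

variable {G : Type*} [Group G]

/-- A sequence `b` of group elements satisfying the braid relations among the first `N` terms, and
commutation of terms at distance at least two. -/
structure IsBraidSeq (N : ℕ) (b : ℕ → G) : Prop where
  comm : ∀ i j, i + 2 ≤ j → Commute (b i) (b j)
  braid : ∀ i, i + 1 < N → b i * b (i + 1) * b i = b (i + 1) * b i * b (i + 1)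

/-- The sequence obtained by folding `b` around its term of index `c`. -/
def foldSeq (b : ℕ → G) (c i : ℕ) : G :=
  if i = 0 then b c else b (c - i) * b (c + i)

lemma IsBraidSeq.foldSeq_comm {N : ℕ} {b : ℕ → G} (hb : IsBraidSeq N b) {c i j : ℕ}
    (hij : i + 2 ≤ j) (hj : j ≤ c) : Commute (foldSeq b c i) (foldSeq b c j) := by
  unfold foldSeq
  rw [if_neg (show j ≠ 0 by omega)]
  split_ifs with hi
  · exact ((hb.comm _ _ (by omega)).symm).mul_right (hb.comm _ _ (by omega))
  · exact ((hb.comm _ _ (by omega)).symm.mul_right (hb.comm _ _ (by omega))).mul_left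
      ((hb.comm _ _ (by omega)).symm.mul_right (hb.comm _ _ (by omega)))

lemma mul_braid_of_commute {a a' d d' : G} (h₁ : Commute a d) (h₂ : Commute a d')
    (h₃ : Commute a' d) (h₄ : Commute a' d') (ha : a * a' * a = a' * a * a')
    (hd : d * d' * d = d' * d * d') :
    (a * d) * (a' * d') * (a * d) = (a' * d') * (a * d) * (a' * d') := by
  have hl : (a * d) * (a' * d') * (a * d) = (a * a' * a) * (d * d' * d) := by
    rw [h₃.symm.mul_mul_mul_comm, (h₁.symm.mul_left h₂.symm).mul_mul_mul_comm]
  have hr : (a' * d') * (a * d) * (a' * d') = (a' * a * a') * (d' * d * d') := by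
    rw [h₂.symm.mul_mul_mul_comm, (h₄.symm.mul_left h₃.symm).mul_mul_mul_comm]
  rw [hl, hr, ha, hd]

lemma IsBraidSeq.foldSeq_braid {N : ℕ} {b : ℕ → G} (hb : IsBraidSeq N b) {c i : ℕ}
    (hi : 1 ≤ i) (hc : i + 1 ≤ c) (hN : c + i + 1 < N) :
    foldSeq b c i * foldSeq b c (i + 1) * foldSeq b c i =
      foldSeq b c (i + 1) * foldSeq b c i * foldSeq b c (i + 1) := by
  unfold foldSeq
  rw [if_neg (by omega), if_neg (by omega)]
  obtain ⟨p, rfl⟩ : ∃ p, c = p + (i + 1) := ⟨c - (i + 1), by omega⟩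
  rw [show p + (i + 1) - i = p + 1 by omega, show p + (i + 1) - (i + 1) = p by omega,
    ← add_assoc (p + (i + 1)) i 1]
  exact mul_braid_of_commute (hb.comm _ _ (by omega)) (hb.comm _ _ (by omega))
    (hb.comm _ _ (by omega)) (hb.comm _ _ (by omega)) (hb.braid _ (by omega)).symm
    (hb.braid _ (by omega))

lemma mul_braid_four {a c d : G} (h : Commute a d) (hac : a * c * a = c * a * c)
    (hcd : c * d * c = d * c * d) :
    c * (a * d) * c * (a * d) = (a * d) * c * (a * d) * c := by
  have h' : a * d = d * a := h
  calc c * (a * d) * c * (a * d) = c * (a * d) * c * (d * a) := congrArg _ h'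
    _ = c * a * (d * c * d) * a := by simp only [mul_assoc]
    _ = (c * a * c) * d * c * a := by rw [← hcd]; simp only [mul_assoc]
    _ = a * c * (a * d) * c * a := by rw [← hac]; simp only [mul_assoc]
    _ = a * c * d * (a * c * a) := by rw [h']; simp only [mul_assoc]
    _ = a * (c * d * c) * a * c := by rw [hac]; simp only [mul_assoc]
    _ = a * d * c * (d * a) * c := by rw [hcd]; simp only [mul_assoc]
    _ = (a * d) * c * (a * d) * c := by rw [← h']

lemma IsBraidSeq.foldSeq_four {N : ℕ} {b : ℕ → G} (hb : IsBraidSeq N b) {c : ℕ}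
    (hc : 1 ≤ c) (hN : c + 1 < N) :
    foldSeq b c 0 * foldSeq b c 1 * foldSeq b c 0 * foldSeq b c 1 =
      foldSeq b c 1 * foldSeq b c 0 * foldSeq b c 1 * foldSeq b c 0 := by
  unfold foldSeq
  obtain ⟨p, rfl⟩ : ∃ p, c = p + 1 := ⟨c - 1, by omega⟩
  simp only [if_true, one_ne_zero, if_false, Nat.add_sub_cancel]
  exact mul_braid_four (hb.comm _ _ (by omega)) (hb.braid _ (by omega)) (hb.braid _ (by omega))

end BraidSequence

section TypeB

variable {G : Type*} [Group G]

lemma BCoxMatrix_apply {n : ℕ} (i j : Fin n) : BCoxMatrix n i j =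
    if i = j then 1
      else (if (i : ℕ) = 0 ∧ (j : ℕ) = 1 ∨ (j : ℕ) = 0 ∧ (i : ℕ) = 1 then 4
        else (if (j : ℕ) + 1 = i ∨ (i : ℕ) + 1 = j then 3 else 2)) := rfl

/-- A sequence of group elements whose first `n` terms satisfy the Artin relations of type `Bₙ`. -/
structure IsArtinBSeq (n : ℕ) (s : ℕ → G) : Prop where
  comm : ∀ i j, i + 2 ≤ j → j < n → s i * s j = s j * s i
  braid : ∀ i, 1 ≤ i → i + 1 < n → s i * s (i + 1) * s i = s (i + 1) * s i * s (i + 1)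
  four : 1 < n → s 0 * s 1 * s 0 * s 1 = s 1 * s 0 * s 1 * s 0

lemma IsArtinBSeq.map {H : Type*} [Group H] {n : ℕ} {s : ℕ → G} (hs : IsArtinBSeq n s)
    (φ : G →* H) : IsArtinBSeq n (fun i => φ (s i)) where
  comm i j hij hj := by simp only [← map_mul, hs.comm i j hij hj]
  braid i hi hj := by simp only [← map_mul, hs.braid i hi hj]
  four h := by simp only [← map_mul, hs.four h]

lemma IsBraidSeq.isArtinBSeq_foldSeq {n : ℕ} {b : ℕ → G} (hb : IsBraidSeq (2 * n - 1) b) :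
    IsArtinBSeq n (foldSeq b (n - 1)) where
  comm _ _ hij hj := hb.foldSeq_comm hij (by omega)
  braid _ hi hj := hb.foldSeq_braid hi (by omega) (by omega)
  four h := hb.foldSeq_four (by omega) (by omega)

lemma IsArtinBSeq.altProd_eq {n : ℕ} {s : ℕ → G} (hs : IsArtinBSeq n s) (i j : Fin n) :
    altProd (s i) (s j) (BCoxMatrix n i j) = altProd (s j) (s i) (BCoxMatrix n i j) := by
  wlog hij : i ≤ j generalizing i j
  · rw [(BCoxMatrix n).symmetric i j]
    exact (this j i (le_of_not_ge hij)).symm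
  obtain ⟨i, hi⟩ := i
  obtain ⟨j, hj⟩ := j
  rw [Fin.mk_le_mk] at hij
  rw [BCoxMatrix_apply]
  simp only [Fin.mk.injEq]
  split_ifs with h₁ h₂ h₃
  · rw [h₁]
  · obtain ⟨rfl, rfl⟩ : i = 0 ∧ j = 1 := by omega
    simpa [altProd, mul_assoc] using hs.four hj
  · obtain rfl : j = i + 1 := by omega
    simpa [altProd, mul_assoc] using hs.braid i (by omega) hj
  · simpa [altProd] using hs.comm i j (by omega) hj

lemma IsArtinBSeq.mul_pow_eq_one {n : ℕ} {s : ℕ → G} (hs : IsArtinBSeq n s)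
    (hsq : ∀ i < n, s i * s i = 1) (i j : Fin n) : (s i * s j) ^ BCoxMatrix n i j = 1 := by
  have h := hs.altProd_eq i j
  have hji : s j * s i = (s i * s j)⁻¹ := by
    rw [mul_inv_rev, inv_eq_of_mul_eq_one_right (hsq i i.2),
      inv_eq_of_mul_eq_one_right (hsq j j.2)]
  rcases Nat.even_or_odd' (BCoxMatrix n i j) with ⟨m, hm | hm⟩
  · rw [hm, altProd_two_mul, altProd_two_mul, hji, inv_pow] at h
    rw [hm, two_mul, pow_add]
    exact mul_eq_one_iff_eq_inv.mpr h
  · rw [hm, altProd_two_mul_add_one, altProd_two_mul_add_one, hji, inv_pow] at h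
    rw [hm, two_mul, add_assoc, pow_add, pow_succ, ← mul_assoc _ (s i) (s j), h,
      mul_assoc _ (s j) (s j), hsq j j.2, mul_one, mul_inv_cancel]

/-- The product `t_{k-d+1} ⋯ t_{k-1} t_k`, where `t_m = s_{|m|}`. For `d ≤ 2 k + 1` these
represent the left cosets of `⟨s₀, …, s_{k-1}⟩` in `⟨s₀, …, s_k⟩`. -/
def cosetRep (s : ℕ → G) (k : ℕ) : ℕ → G
  | 0 => 1
  | d + 1 => s ((k : ℤ) - d).natAbs * cosetRep s k d

lemma IsArtinBSeq.exists_mul_cosetRep_eq {n : ℕ} {s : ℕ → G} (hs : IsArtinBSeq n s)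
    {k : ℕ} (hk : k < n) (d : ℕ) (hd : d ≤ 2 * k + 1) (i : ℕ) (hi : i ≤ k)
    (h₁ : i ≠ ((k : ℤ) + 1 - d).natAbs) (h₂ : i ≠ ((k : ℤ) - d).natAbs) :
    ∃ j < k, s i * cosetRep s k d = cosetRep s k d * s j := by
  induction d using Nat.strong_induction_on generalizing i with
  | _ d ih =>
  obtain _ | d := d
  · exact ⟨i, by omega, by simp [cosetRep]⟩
  by_cases hfar : i + 2 ≤ ((k : ℤ) - d).natAbs ∨ ((k : ℤ) - d).natAbs + 2 ≤ i
  · have hc : s i * s ((k : ℤ) - d).natAbs = s ((k : ℤ) - d).natAbs * s i := by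
      rcases hfar with h | h
      · exact hs.comm _ _ h (by omega)
      · exact (hs.comm _ _ h (by omega)).symm
    obtain ⟨j, hj, h⟩ := ih d (by omega) (by omega) i hi (by omega) (by omega)
    exact ⟨j, hj, by rw [cosetRep, ← mul_assoc, hc, mul_assoc, h, mul_assoc]⟩
  obtain _ | d := d
  · omega
  by_cases hzero : i = 0
  · subst hzero
    obtain _ | d := d
    · omega
    obtain rfl : k = d + 1 := by omega
    obtain ⟨j, hj, h⟩ := ih d (by omega) (by omega) 0 (by omega) (by omega) (by omega)
    refine ⟨j, hj, ?_⟩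
    simp only [cosetRep]
    rw [show (((d + 1 : ℕ) : ℤ) - (d + 1 + 1 : ℕ)).natAbs = 1 by omega,
      show (((d + 1 : ℕ) : ℤ) - (d + 1 : ℕ)).natAbs = 0 by omega,
      show (((d + 1 : ℕ) : ℤ) - (d : ℕ)).natAbs = 1 by omega]
    simp only [← mul_assoc]
    rw [hs.four (by omega)]
    simp only [mul_assoc]
    rw [h]
  set a := ((k : ℤ) - (d + 1 : ℕ)).natAbs with ha
  have hb : ((k : ℤ) - d).natAbs = i := by omega
  have hbr : s i * s a * s i = s a * s i * s a := by
    rcases (show a = i + 1 ∨ i = a + 1 by omega) with h | h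
    · rw [h]; exact hs.braid i (by omega) (by omega)
    · rw [h]; exact (hs.braid a (by omega) (by omega)).symm
  obtain ⟨j, hj, h⟩ := ih d (by omega) (by omega) a (by omega) (by omega) (by omega)
  refine ⟨j, hj, ?_⟩
  rw [cosetRep, cosetRep, ← ha, hb]
  simp only [← mul_assoc]
  rw [hbr]
  simp only [mul_assoc]
  rw [h]

lemma IsArtinBSeq.exists_eq_cosetRep_mul {n : ℕ} {s : ℕ → G} (hs : IsArtinBSeq n s)
    (hsq : ∀ i < n, s i * s i = 1) {k : ℕ} (hk : k < n) {w : G}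
    (hw : w ∈ Subgroup.closure (s '' Set.Iio (k + 1))) :
    ∃ d ≤ 2 * k + 1, ∃ v ∈ Subgroup.closure (s '' Set.Iio k), w = cosetRep s k d * v := by
  have step : ∀ i ≤ k, ∀ d ≤ 2 * k + 1, ∃ d' ≤ 2 * k + 1,
      ∃ v ∈ Subgroup.closure (s '' Set.Iio k),
        s i * cosetRep s k d = cosetRep s k d' * v := by
    intro i hi d hd
    by_cases h₁ : i = ((k : ℤ) + 1 - d).natAbs ∧ 0 < d
    · obtain ⟨d, rfl⟩ : ∃ d', d = d' + 1 := ⟨d - 1, by omega⟩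
      refine ⟨d, by omega, 1, one_mem _, ?_⟩
      rw [cosetRep, show ((k : ℤ) - d).natAbs = i by omega, ← mul_assoc, hsq i (by omega),
        one_mul, mul_one]
    by_cases h₂ : i = ((k : ℤ) - d).natAbs ∧ d < 2 * k + 1
    · exact ⟨d + 1, by omega, 1, one_mem _, by rw [cosetRep, ← h₂.1, mul_one]⟩
    obtain ⟨j, hj, h⟩ := hs.exists_mul_cosetRep_eq hk d hd i hi (by omega) (by omega)
    exact ⟨d, hd, s j, Subgroup.subset_closure ⟨j, hj, rfl⟩, h⟩
  have step' : ∀ i ≤ k, ∀ w : G,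
      (∃ d ≤ 2 * k + 1, ∃ v ∈ Subgroup.closure (s '' Set.Iio k), w = cosetRep s k d * v) →
      ∃ d ≤ 2 * k + 1, ∃ v ∈ Subgroup.closure (s '' Set.Iio k),
        s i * w = cosetRep s k d * v := by
    rintro i hi _ ⟨d, hd, v, hv, rfl⟩
    obtain ⟨d', hd', v', hv', h⟩ := step i hi d hd
    exact ⟨d', hd', v' * v, mul_mem hv' hv, by rw [← mul_assoc, h, mul_assoc]⟩
  induction hw using Subgroup.closure_induction_left with
  | one => exact ⟨0, by omega, 1, one_mem _, by simp [cosetRep]⟩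
  | mul_left x hx y _ ih =>
    obtain ⟨i, hi, rfl⟩ := hx
    exact step' i (Nat.lt_succ_iff.mp hi) y ih
  | inv_mul_cancel x hx y _ ih =>
    obtain ⟨i, hi, rfl⟩ := hx
    have hi : i ≤ k := Nat.lt_succ_iff.mp hi
    rw [inv_eq_of_mul_eq_one_right (hsq i (by omega))]
    exact step' i hi y ih

/-- A permutation representation of a group generated by involutions satisfying the Artin relations
of type `Bₙ` is faithful as soon as the generators move points with coordinates `q` in
`{-n + 1, …, n}` like the standard folded transpositions. -/
lemma IsArtinBSeq.eq_one_of_map_eq_one {n : ℕ} {s : ℕ → G} (hs : IsArtinBSeq n s)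
    (hsq : ∀ i < n, s i * s i = 1) {α : Type*} (φ : G →* Equiv.Perm α) (q : α → ℤ)
    (hmove : ∀ (m : ℤ) (x : α), m.natAbs < n → q x = m + 1 → q (φ (s m.natAbs) x) = m)
    (hfix : ∀ i k x, i < k → k < n → q x = k + 1 → φ (s i) x = x)
    (hq : ∀ k < n, ∃ x, q x = k + 1) {k : ℕ} (hk : k ≤ n) {w : G}
    (hw : w ∈ Subgroup.closure (s '' Set.Iio k)) (h : φ w = 1) : w = 1 := by
  induction k generalizing w with
  | zero => simpa using hw
  | succ k ih =>
    obtain ⟨d, hd, v, hv, rfl⟩ := hs.exists_eq_cosetRep_mul hsq hk hw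
    obtain ⟨x, hx⟩ := hq k hk
    have hvx : φ v x = x := by
      have hle : Subgroup.closure (s '' Set.Iio k) ≤
          (MulAction.stabilizer (Equiv.Perm α) x).comap φ := by
        rw [Subgroup.closure_le]
        rintro _ ⟨i, hi, rfl⟩
        exact hfix i k x hi hk hx
      exact hle hv
    have hrep : ∀ d ≤ 2 * k + 1, q (φ (cosetRep s k d) x) = k + 1 - d := by
      intro d hd
      induction d with
      | zero => simp [cosetRep, hx]
      | succ d ihd =>
        rw [cosetRep, map_mul, Equiv.Perm.mul_apply, hmove _ _ (by omega)]
        · push_cast; ring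
        · rw [ihd (by omega)]; ring
    have hd0 := hrep d hd
    have hone : φ (cosetRep s k d) x = x := by
      conv_lhs => rw [← hvx, ← Equiv.Perm.mul_apply, ← map_mul, h]
      rfl
    rw [hone, hx] at hd0
    obtain rfl : d = 0 := by omega
    rw [cosetRep, one_mul] at h ⊢
    exact ih (by omega) hv h

end TypeB

section Representation

/-- The braid generators indexed by all natural numbers, trivial out of range. -/
def braidSeq (m i : ℕ) : BraidGroup m :=
  if h : i < m - 1 then σ ⟨i, h⟩ else 1

lemma braidSeq_of_lt {m i : ℕ} (h : i < m - 1) : braidSeq m i = σ ⟨i, h⟩ := dif_pos h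

lemma isBraidSeq_braidSeq (m : ℕ) : IsBraidSeq (m - 1) (braidSeq m) where
  comm i j hij := by
    by_cases hj : j < m - 1
    · rw [braidSeq_of_lt hj, braidSeq_of_lt (by omega)]
      have h : (PresentedGroup.mk (braidRels m)) _ = 1 := PresentedGroup.one_of_mem
        (Or.inl ⟨⟨i, by omega⟩, ⟨j, hj⟩, hij, rfl⟩)
      simp only [map_mul, map_inv] at h
      exact mul_inv_eq_iff_eq_mul.mp (mul_inv_eq_one.mp h)
    · rw [braidSeq, braidSeq, dif_neg hj]
      exact Commute.one_right _
  braid i hi := by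
    rw [braidSeq_of_lt hi, braidSeq_of_lt (by omega)]
    have h : (PresentedGroup.mk (braidRels m)) _ = 1 := PresentedGroup.one_of_mem
      (Or.inr ⟨⟨i, by omega⟩, ⟨i + 1, hi⟩, rfl, rfl⟩)
    simp only [map_mul, map_inv] at h
    exact mul_inv_eq_one.mp h

lemma braidToPerm_σ {m : ℕ} (i : Fin (m - 1)) : braidToPerm m (σ i) = braidGen m i :=
  PresentedGroup.toGroup.of _

lemma braidToPerm_braidSeq_apply {m i : ℕ} (h : i < m - 1) (x : Fin m) :
    (braidToPerm m (braidSeq m i) x : ℕ) =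
      if (x : ℕ) = i then i + 1 else if (x : ℕ) = i + 1 then i else x := by
  rw [braidSeq_of_lt h, braidToPerm_σ, braidGen, Equiv.swap_apply_def]
  simp only [Fin.ext_iff]
  split_ifs <;> rfl

lemma braidToPerm_foldSeq_apply {n i : ℕ} (h : i < n) (x : Fin (2 * n)) :
    (braidToPerm (2 * n) (foldSeq (braidSeq (2 * n)) (n - 1) i) x : ℕ) =
      if (x : ℕ) + i + 1 = n then n - i else if (x : ℕ) + i = n then n - i - 1
        else if (x : ℕ) + 1 = n + i then n + i else if (x : ℕ) = n + i then n + i - 1 else x := by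
  unfold foldSeq
  split_ifs <;>
    simp only [map_mul, Equiv.Perm.mul_apply,
      braidToPerm_braidSeq_apply (show n - 1 < 2 * n - 1 by omega),
      braidToPerm_braidSeq_apply (show n - 1 - i < 2 * n - 1 by omega),
      braidToPerm_braidSeq_apply (show n - 1 + i < 2 * n - 1 by omega)] <;>
    split_ifs <;> omega

/-- The Coxeter generators of type `Bₙ` indexed by all natural numbers, trivial out of range. -/
def coxSeq (n i : ℕ) : BCoxGroup n :=
  if h : i < n then (BCoxMatrix n).simple ⟨i, h⟩ else 1

lemma coxSeq_of_lt {n i : ℕ} (h : i < n) : coxSeq n i = (BCoxMatrix n).simple ⟨i, h⟩ := dif_pos h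

lemma coxSeq_mul_self {n : ℕ} (i : ℕ) (h : i < n) : coxSeq n i * coxSeq n i = 1 := by
  rw [coxSeq_of_lt h]
  exact (BCoxMatrix n).toCoxeterSystem.simple_mul_simple_self _

lemma isArtinBSeq_coxSeq (n : ℕ) : IsArtinBSeq n (coxSeq n) := by
  have key : ∀ i j (hi : i < n) (hj : j < n),
      altProd (coxSeq n i) (coxSeq n j) (BCoxMatrix n ⟨i, hi⟩ ⟨j, hj⟩) =
        altProd (coxSeq n j) (coxSeq n i) (BCoxMatrix n ⟨i, hi⟩ ⟨j, hj⟩) := by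
    intro i j hi hj
    refine altProd_swap_eq (coxSeq_mul_self i hi) (coxSeq_mul_self j hj) ?_
    rw [coxSeq_of_lt hi, coxSeq_of_lt hj]
    exact (BCoxMatrix n).toCoxeterSystem.simple_mul_simple_pow ⟨i, hi⟩ ⟨j, hj⟩
  refine ⟨fun i j hij hj => ?_, fun i hi hj => ?_, fun h => ?_⟩
  · have h := key i j (by omega) hj
    simp only [BCoxMatrix_apply, Fin.mk.injEq] at h
    rw [if_neg (by omega), if_neg (by omega), if_neg (by omega)] at h
    simpa [altProd] using h
  · have h := key i (i + 1) (by omega) hj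
    simp only [BCoxMatrix_apply, Fin.mk.injEq] at h
    rw [if_neg (by omega), if_neg (by omega), if_pos (by simp)] at h
    simpa [altProd, mul_assoc] using h
  · have h := key 0 1 (by omega) h
    simp only [BCoxMatrix_apply, Fin.mk.injEq] at h
    rw [if_neg (by omega), if_pos (by simp)] at h
    simpa [altProd, mul_assoc] using h

lemma closure_coxSeq (n : ℕ) : Subgroup.closure (coxSeq n '' Set.Iio n) = ⊤ := by
  rw [eq_top_iff, ← (BCoxMatrix n).toCoxeterSystem.subgroup_closure_range_simple]
  refine Subgroup.closure_mono ?_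
  rintro _ ⟨i, rfl⟩
  exact ⟨i, i.2, coxSeq_of_lt i.2⟩

/-- The folding homomorphism from the Artin group of type `Bₙ` to the braid group. -/
def artinBToBraid (n : ℕ) : ArtinB n →* BraidGroup (2 * n) :=
  PresentedGroup.toGroup (f := fun i : Fin n => foldSeq (braidSeq (2 * n)) (n - 1) i) (by
    rintro r ⟨i, j, -, rfl⟩
    rw [map_mul, map_inv, mul_inv_eq_one, map_altProd, map_altProd,
      FreeGroup.lift_apply_of, FreeGroup.lift_apply_of]
    exact (isBraidSeq_braidSeq (2 * n)).isArtinBSeq_foldSeq.altProd_eq i j)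

lemma artinBToBraid_of {n : ℕ} (i : Fin n) : artinBToBraid n (PresentedGroup.of i) =
    foldSeq (braidSeq (2 * n)) (n - 1) i :=
  PresentedGroup.toGroup.of _

lemma braidToPerm_foldSeq_mul_self {n : ℕ} (i : ℕ) (h : i < n) :
    braidToPerm (2 * n) (foldSeq (braidSeq (2 * n)) (n - 1) i) *
      braidToPerm (2 * n) (foldSeq (braidSeq (2 * n)) (n - 1) i) = 1 := by
  ext x
  rw [Equiv.Perm.mul_apply, Equiv.Perm.one_apply, braidToPerm_foldSeq_apply h,
    braidToPerm_foldSeq_apply h]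
  split_ifs <;> omega

/-- The permutation representation of the Coxeter group of type `Bₙ` on `2 n` letters. -/
def coxBToPerm (n : ℕ) : BCoxGroup n →* Equiv.Perm (Fin (2 * n)) :=
  (BCoxMatrix n).toCoxeterSystem.lift
    ⟨fun i => braidToPerm (2 * n) (foldSeq (braidSeq (2 * n)) (n - 1) i),
      ((isBraidSeq_braidSeq (2 * n)).isArtinBSeq_foldSeq.map (braidToPerm (2 * n))).mul_pow_eq_one
        braidToPerm_foldSeq_mul_self⟩

lemma coxBToPerm_simple {n : ℕ} (i : Fin n) : coxBToPerm n ((BCoxMatrix n).simple i) =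
    braidToPerm (2 * n) (foldSeq (braidSeq (2 * n)) (n - 1) i) :=
  (BCoxMatrix n).toCoxeterSystem.lift_apply_simple _ i

lemma coxBToPerm_coxSeq_apply {n i : ℕ} (h : i < n) (x : Fin (2 * n)) :
    (coxBToPerm n (coxSeq n i) x : ℕ) =
      if (x : ℕ) + i + 1 = n then n - i else if (x : ℕ) + i = n then n - i - 1
        else if (x : ℕ) + 1 = n + i then n + i else if (x : ℕ) = n + i then n + i - 1 else x := by
  rw [coxSeq_of_lt h, coxBToPerm_simple, braidToPerm_foldSeq_apply h]

lemma coxBToPerm_injective (n : ℕ) : Function.Injective (coxBToPerm n) := by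
  rw [injective_iff_map_eq_one]
  intro w hw
  refine (isArtinBSeq_coxSeq n).eq_one_of_map_eq_one coxSeq_mul_self (coxBToPerm n)
    (fun x => (x : ℤ) - (n - 1)) ?_ ?_ ?_ le_rfl (by rw [closure_coxSeq]; trivial) hw
  · intro m x hm hx
    have := coxBToPerm_coxSeq_apply hm x
    beta_reduce at hx ⊢
    split_ifs at this <;> omega
  · intro i k x hi hk hx
    have := coxBToPerm_coxSeq_apply (hi.trans hk) x
    beta_reduce at hx
    ext
    split_ifs at this <;> omega
  · intro k hk
    exact ⟨⟨n + k, by omega⟩, by push_cast; ring⟩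

lemma braidToPerm_artinBToBraid {n : ℕ} (x : ArtinB n) :
    braidToPerm (2 * n) (artinBToBraid n x) = coxBToPerm n (artinBToCox n x) := by
  have h : (braidToPerm (2 * n)).comp (artinBToBraid n) =
      (coxBToPerm n).comp (artinBToCox n) := by
    refine PresentedGroup.ext fun i => ?_
    rw [MonoidHom.comp_apply, MonoidHom.comp_apply, artinBToBraid_of, artinBToCox,
      PresentedGroup.toGroup.of, coxBToPerm_simple]
  exact DFunLike.congr_fun h x

lemma foldSeq_braidSeq_zero {n : ℕ} (hn : 0 < n) :
    foldSeq (braidSeq (2 * n)) (n - 1) 0 = σ (m := 2 * n) ⟨n - 1, by omega⟩ := by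
  rw [foldSeq, if_pos rfl, braidSeq_of_lt]

lemma foldSeq_braidSeq_sub_one {n i : ℕ} (hi : 2 ≤ i) (hin : i ≤ n) :
    foldSeq (braidSeq (2 * n)) (n - 1) (i - 1) =
      σ (m := 2 * n) ⟨n - i, by omega⟩ * σ (m := 2 * n) ⟨n + i - 2, by omega⟩ := by
  rw [foldSeq, if_neg (by omega), braidSeq_of_lt (by omega), braidSeq_of_lt (by omega)]
  congr 3 <;> omega

end Representation


/-- Let `n ≥ 2`. There exist a homomorphism `f` from the Artin group of
type `Bₙ` to the braid group on `2n` strands with `f s₁ = σₙ` and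
`f sᵢ = σ_{n-i+1} σ_{n+i-1}` for `2 ≤ i ≤ n`, and an injective homomorphism `e` from the
Coxeter group of type `Bₙ` into `S_{2n}` with `e s₁ = (n, n+1)` and
`e sᵢ = (n-i+1, n-i+2)(n+i-1, n+i)` for `2 ≤ i ≤ n` (written here `0`-indexed on
`Fin (2n)`), such that `π_{2n} ∘ f = e ∘ π_S`. -/
theorem artinB_braid_representation (n : ℕ) (hn : 2 ≤ n) :
    ∃ (f : ArtinB n →* BraidGroup (2 * n))
      (e : BCoxGroup n →* Equiv.Perm (Fin (2 * n))),
      f (PresentedGroup.of ⟨0, by omega⟩) = σ (m := 2 * n) ⟨n - 1, by omega⟩ ∧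
      (∀ (i : ℕ) (_h2 : 2 ≤ i) (_hin : i ≤ n),
        f (PresentedGroup.of ⟨i - 1, by omega⟩) =
          σ (m := 2 * n) ⟨n - i, by omega⟩ * σ (m := 2 * n) ⟨n + i - 2, by omega⟩) ∧
      Function.Injective e ∧
      e ((BCoxMatrix n).simple ⟨0, by omega⟩) =
        Equiv.swap (⟨n - 1, by omega⟩ : Fin (2 * n)) ⟨n, by omega⟩ ∧
      (∀ (i : ℕ) (_h2 : 2 ≤ i) (_hin : i ≤ n),
        e ((BCoxMatrix n).simple ⟨i - 1, by omega⟩) =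
          Equiv.swap (⟨n - i, by omega⟩ : Fin (2 * n)) ⟨n - i + 1, by omega⟩ *
          Equiv.swap (⟨n + i - 2, by omega⟩ : Fin (2 * n)) ⟨n + i - 1, by omega⟩) ∧
      ∀ x : ArtinB n, braidToPerm (2 * n) (f x) = e (artinBToCox n x) := by
  refine ⟨artinBToBraid n, coxBToPerm n, ?_, ?_, coxBToPerm_injective n, ?_, ?_,
    braidToPerm_artinBToBraid⟩
  · rw [artinBToBraid_of]
    exact foldSeq_braidSeq_zero (by omega)
  · intro i h2 hin
    rw [artinBToBraid_of]
    exact foldSeq_braidSeq_sub_one h2 hin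
  · rw [coxBToPerm_simple, foldSeq_braidSeq_zero (by omega), braidToPerm_σ, braidGen]
    congr 1
    simp only [Fin.mk.injEq]
    omega
  · intro i h2 hin
    rw [coxBToPerm_simple, foldSeq_braidSeq_sub_one h2 hin, map_mul, braidToPerm_σ, braidToPerm_σ,
      braidGen, braidGen]
    congr 2
    simp only [Fin.mk.injEq]
    omega
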